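/- arXiv:1001.0324 — 3 statements merged into one kernel-verified Lean document; each statement's English description precedes it below -/
import Mathlib

section
/- The quotient of the polynomial ring ℂ[Y₀,Y₁,Y₂,Y₃,X₀,X₁,X₂,X₃] by the ideal generated by F₀, F₁, F₂, F₃ is an integral domain which is integrally closed in its field of fractions (i.e. it is a normal domain). -/
open MvPolynomial

/-- The defining polynomials `F₀, F₁, F₂, F₃` in the variables
`Y₀,Y₁,Y₂,Y₃,X₀,X₁,X₂,X₃`, where variable `i` (for `i < 4`) is `Yᵢ` and
variable `4+i` is `Xᵢ`. -/
noncomputable def vgnF : Fin 4 → MvPolynomial (Fin 8) ℂ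
  | 0 => X 0 ^ 2 - (X 4 ^ 2 + X 5 ^ 2 + X 6 ^ 2 + X 7 ^ 2)
  | 1 => X 1 ^ 2 - (X 4 ^ 2 - X 5 ^ 2 + X 6 ^ 2 - X 7 ^ 2)
  | 2 => X 2 ^ 2 - (X 4 ^ 2 + X 5 ^ 2 - X 6 ^ 2 - X 7 ^ 2)
  | 3 => X 3 ^ 2 - (X 4 ^ 2 - X 5 ^ 2 - X 6 ^ 2 + X 7 ^ 2)

set_option linter.all false

/-- `t` is not a square in the fraction field, and `c² t ∈ B` implies `c ∈ B`. -/
def VgnGood (B : Type*) [CommRing B] (t : B) : Prop :=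
  (∀ s a : B, s ≠ 0 → s ^ 2 ∣ a ^ 2 * t → s ∣ a) ∧ ∀ s a : B, s ^ 2 * t = a ^ 2 → s = 0

theorem vgn_dvd_of_integral {B F : Type*} [CommRing B] [IsDomain B] [IsIntegrallyClosed B]
    [Field F] [Algebra B F] (inj : Function.Injective (algebraMap B F)) (s t : B) (hs : s ≠ 0)
    (h : IsIntegral B (algebraMap B F t / algebraMap B F s)) : s ∣ t := by
  let g : FractionRing B →ₐ[B] F := IsFractionRing.liftAlgHom (g := Algebra.ofId B F) inj
  have hg : g (algebraMap B (FractionRing B) t / algebraMap B (FractionRing B) s) =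
      algebraMap B F t / algebraMap B F s := by
    rw [map_div₀, g.commutes, g.commutes]
  rw [← hg, isIntegral_algHom_iff g g.toRingHom.injective] at h
  obtain ⟨y, hy⟩ := IsIntegrallyClosed.isIntegral_iff.mp h
  have hs' : algebraMap B (FractionRing B) s ≠ 0 := by
    simpa using hs
  rw [eq_div_iff hs', ← map_mul] at hy
  exact ⟨y, by rw [← IsFractionRing.injective B (FractionRing B) hy, mul_comm]⟩

abbrev VgnQ (B : Type*) [CommRing B] (q : B) := QuadraticAlgebra B q 0

theorem vgn_mul_star {B : Type*} [CommRing B] {q : B} (x : VgnQ B q) : x * star x = algebraMap B _ x.norm :=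
  (QuadraticAlgebra.algebraMap_norm_eq_mul_star x).symm

section step
variable {B : Type*} [CommRing B] [IsDomain B] {q : B}

theorem vgn_norm_eq_zero (hq : VgnGood B q) (x : VgnQ B q) (h : x.norm = 0) : x = 0 := by
  rw [QuadraticAlgebra.norm_def] at h
  have h1 : x.im = 0 := hq.2 _ x.re (by linear_combination -h)
  have h2 : x.re = 0 := by
    rw [h1] at h
    have : x.re ^ 2 = 0 := by linear_combination h
    simpa using this
  ext <;> simp [h1, h2]

theorem vgn_isDomain (hq : VgnGood B q) : IsDomain (VgnQ B q) := by
  have : NoZeroDivisors (VgnQ B q) := by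
    refine ⟨fun {x y} h => ?_⟩
    have : x.norm * y.norm = 0 := by rw [← map_mul, h, QuadraticAlgebra.norm_zero]
    rcases mul_eq_zero.mp this with h | h
    · exact .inl (vgn_norm_eq_zero hq _ h)
    · exact .inr (vgn_norm_eq_zero hq _ h)
  exact NoZeroDivisors.to_isDomain _

theorem vgn_good_step [IsIntegrallyClosed B] (h2 : IsUnit (2 : B)) (hq : VgnGood B q) (t : B)
    (ht : VgnGood B t) (hqt : VgnGood B (q * t)) :
    VgnGood (VgnQ B q) (algebraMap B _ t) := by
  have := vgn_isDomain hq
  constructor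
  · intro S A hS hd
    have hSS : star S ≠ 0 := by simpa using hS
    have hs : S.norm ≠ 0 := fun h => hS (vgn_norm_eq_zero hq _ h)
    rw [← mul_dvd_mul_iff_right hSS, vgn_mul_star]
    have hd' : algebraMap B (VgnQ B q) (S.norm ^ 2) ∣ (A * star S) ^ 2 * algebraMap B _ t := by
      rw [map_pow, ← vgn_mul_star, mul_pow, mul_pow,
        mul_right_comm]
      exact mul_dvd_mul_right hd _
    generalize A * star S = x at hd' ⊢
    generalize S.norm = s at hd' hs ⊢
    obtain ⟨a, b⟩ := x
    rw [QuadraticAlgebra.algebraMap_dvd_iff] at hd' ⊢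
    simp [pow_two] at hd' ⊢
    obtain ⟨hu, hv⟩ := hd'
    have hw : s * s ∣ (a * a - q * b * b) * t := by
      rw [← IsIntegrallyClosed.pow_dvd_pow_iff two_ne_zero]
      obtain ⟨u, hu⟩ := hu
      obtain ⟨v, hv⟩ := hv
      refine ⟨u ^ 2 - q * v ^ 2, ?_⟩
      linear_combination ((a * a + q * b * b) * t + s * s * u) * hu -
        q * ((a * b + b * a) * t + s * s * v) * hv
    constructor
    · apply ht.1 s a hs
      rw [← h2.dvd_mul_left]
      convert dvd_add hu hw using 1 <;> ring
    · apply hqt.1 s b hs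
      rw [← h2.dvd_mul_left]
      convert dvd_sub hu hw using 1 <;> ring
  · intro S A h
    apply vgn_norm_eq_zero hq
    have h' : algebraMap B (VgnQ B q) (S.norm ^ 2 * t) = (A * star S) ^ 2 := by
      rw [map_mul, map_pow, ← vgn_mul_star, mul_pow, mul_pow, ← h]
      ring
    generalize A * star S = x at h'
    generalize S.norm = s at h'
    obtain ⟨a, b⟩ := x
    have hr := congrArg QuadraticAlgebra.re h'
    have hi := congrArg QuadraticAlgebra.im h'
    simp [pow_two] at hr hi
    have : 2 * (a * b) = 0 := by linear_combination -hi
    rcases mul_eq_zero.mp (h2.mul_right_eq_zero.mp this) with h | h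
    · refine hqt.2 s (q * b) ?_
      rw [h] at hr
      linear_combination q * hr
    · refine ht.2 s a ?_
      rw [h] at hr
      linear_combination hr

theorem vgn_ic_step' [IsIntegrallyClosed B] (h2 : IsUnit (2 : B)) (hq : VgnGood B q)
    [IsDomain (VgnQ B q)] (F : Type*) [Field F] [Algebra (VgnQ B q) F] [IsFractionRing (VgnQ B q) F]
    [Algebra B F] [IsScalarTower B (VgnQ B q) F] :
    IsIntegrallyClosed (VgnQ B q) := by
  have hinj' : Function.Injective (algebraMap (VgnQ B q) F) := IsFractionRing.injective _ _
  have hinj : Function.Injective (algebraMap B F) := by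
    rw [IsScalarTower.algebraMap_eq B (VgnQ B q) F]
    exact hinj'.comp QuadraticAlgebra.algebraMap_injective
  rw [isIntegrallyClosed_iff F]
  intro z hz
  obtain ⟨A, S, hS, rfl⟩ := IsFractionRing.div_surjective (A := VgnQ B q) z
  have hS0 : S ≠ 0 := nonZeroDivisors.ne_zero hS
  have hs : S.norm ≠ 0 := fun h => hS0 (vgn_norm_eq_zero hq _ h)
  have hSS : star S ≠ 0 := by simpa using hS0
  have hS' : algebraMap _ F S ≠ 0 := by simpa using hS0
  have hSS' : algebraMap _ F (star S) ≠ 0 := by simpa using hSS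
  have hz2 : algebraMap _ F A / algebraMap _ F S =
      algebraMap _ F (A * star S) / algebraMap _ F (algebraMap B (VgnQ B q) S.norm) := by
    rw [← vgn_mul_star, map_mul, map_mul]
    field_simp
  rw [hz2] at hz ⊢
  generalize A * star S = x at hz ⊢
  generalize S.norm = s at hz hs ⊢
  have hsF : algebraMap _ F (algebraMap B (VgnQ B q) s) ≠ 0 := by
    rw [← IsScalarTower.algebraMap_apply]
    exact (map_ne_zero_iff _ hinj).2 hs
  have hz' : IsIntegral (VgnQ B q) (algebraMap _ F (star x) /
      algebraMap _ F (algebraMap B (VgnQ B q) s)) := by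
    let σ : VgnQ B q ≃+* VgnQ B q := starRingAut
    let τ : F ≃+* F := IsFractionRing.ringEquivOfRingEquiv σ
    have hτ : ∀ y, τ (algebraMap _ F y) = algebraMap _ F (star y) := fun y =>
      IsFractionRing.ringEquivOfRingEquiv_algebraMap σ y
    have := hz.map_of_comp_eq σ.toRingHom τ.toRingHom (by
      ext y
      exact (hτ y).symm)
    have e : τ.toRingHom (algebraMap _ F x / algebraMap _ F (algebraMap B (VgnQ B q) s)) = 
       (algebraMap _ F (star x) / algebraMap _ F (algebraMap B (VgnQ B q) s)) := by
      change τ _ = _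
      rw [map_div₀, hτ, hτ]
      congr 2
      ext <;> simp
    rwa [e] at this
  obtain ⟨a, b⟩ := x
  have ha : s ∣ a := by
    rw [← h2.dvd_mul_left]
    apply vgn_dvd_of_integral hinj _ _ hs
    have := isIntegral_trans (R := B) _ (hz.add hz')
    refine Eq.mpr (congrArg (IsIntegral B) ?_) this
    rw [IsScalarTower.algebraMap_apply B (VgnQ B q) F, IsScalarTower.algebraMap_apply B (VgnQ B q) F,
      ← add_div, ← map_add]
    congr 2
    ext <;> simp [two_mul]
  have hb : s ∣ b := by
    apply hq.1 s b hs
    rw [← (h2.pow 2).dvd_mul_left]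
    apply vgn_dvd_of_integral hinj _ _ (pow_ne_zero 2 hs)
    have := isIntegral_trans (R := B) _ ((hz.sub hz').pow 2)
    refine Eq.mpr (congrArg (IsIntegral B) ?_) this
    rw [IsScalarTower.algebraMap_apply B (VgnQ B q) F, IsScalarTower.algebraMap_apply B (VgnQ B q) F,
      ← sub_div, ← map_sub, div_pow, ← map_pow, ← map_pow, ← map_pow]
    congr 2
    ext <;> simp [pow_two] <;> ring
  obtain ⟨c, rfl⟩ := ha
  obtain ⟨d, rfl⟩ := hb
  refine ⟨⟨c, d⟩, ?_⟩
  rw [eq_div_iff hsF, ← map_mul]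
  congr 1
  ext <;> simp [mul_comm]

theorem vgn_ic_step [IsIntegrallyClosed B] (h2 : IsUnit (2 : B)) (hq : VgnGood B q) :
    IsIntegrallyClosed (VgnQ B q) := by
  have := vgn_isDomain hq
  exact vgn_ic_step' h2 hq (FractionRing (VgnQ B q))

end step

def VgnAllGood (B : Type*) [CommRing B] (l : List B) : Prop :=
  ∀ l' : List B, l'.Sublist l → l' ≠ [] → VgnGood B l'.prod

theorem vgn_step {B : Type*} [CommRing B] (q : B) (l : List B)
    (h : IsDomain B ∧ IsIntegrallyClosed B ∧ IsUnit (2 : B) ∧ VgnAllGood B (q :: l)) :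
    IsDomain (VgnQ B q) ∧ IsIntegrallyClosed (VgnQ B q) ∧ IsUnit (2 : VgnQ B q) ∧
      VgnAllGood (VgnQ B q) (l.map (algebraMap B (VgnQ B q))) := by
  obtain ⟨_, _, h2, hg⟩ := h
  have hq : VgnGood B q := by simpa using hg [q] (by simp) (by simp)
  refine ⟨vgn_isDomain hq, vgn_ic_step h2 hq, ?_, ?_⟩
  · have := h2.map (algebraMap B (VgnQ B q))
    rwa [map_ofNat] at this
  intro l' hl' hne
  obtain ⟨m, hm, rfl⟩ := List.sublist_map_iff.mp hl'
  rw [← map_list_prod]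
  have hne' : m ≠ [] := by
    rintro rfl
    simp at hne
  refine vgn_good_step h2 hq _ (hg m (hm.cons _) hne') ?_
  simpa using hg (q :: m) (hm.cons_cons _) (by simp)

def vgnLift {B R : Type*} [CommRing B] [CommRing R] {q : B} (f : B →+* R) (r : R)
    (h : r ^ 2 = f q) : VgnQ B q →+* R where
  toFun z := f z.re + f z.im * r
  map_one' := by simp [QuadraticAlgebra.re_one, QuadraticAlgebra.im_one]
  map_zero' := by simp
  map_add' x y := by simp only [QuadraticAlgebra.re_add, QuadraticAlgebra.im_add, map_add]; ring
  map_mul' x y := by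
    simp only [QuadraticAlgebra.re_mul, QuadraticAlgebra.im_mul, map_add, map_mul, map_zero]
    linear_combination (- f x.im * f y.im) * h

theorem vgnLift_algebraMap {B R : Type*} [CommRing B] [CommRing R] {q : B} (f : B →+* R) (r : R)
    (h : r ^ 2 = f q) (x : B) : vgnLift f r h (algebraMap B _ x) = f x := by
  simp [vgnLift]

theorem vgnLift_omega {B R : Type*} [CommRing B] [CommRing R] {q : B} (f : B →+* R) (r : R)
    (h : r ^ 2 = f q) : vgnLift f r h (QuadraticAlgebra.omega) = r := by
  simp [vgnLift]

theorem vgn_hom_ext {B R : Type*} [CommRing B] [CommRing R] {q : B} {f g : VgnQ B q →+* R}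
    (h : f.comp (algebraMap B _) = g.comp (algebraMap B _))
    (h' : f QuadraticAlgebra.omega = g QuadraticAlgebra.omega) : f = g := by
  ext z
  have hz : z = algebraMap B _ z.re + algebraMap B _ z.im * QuadraticAlgebra.omega := by
    ext <;> simp
  have h1 : ∀ x, f (algebraMap B _ x) = g (algebraMap B _ x) := fun x => RingHom.congr_fun h x
  rw [hz, map_add, map_add, map_mul, map_mul, h1, h1, h']

theorem vgn_omega_sq {B : Type*} [CommRing B] {q : B} :
    (QuadraticAlgebra.omega : VgnQ B q) ^ 2 = algebraMap B _ q := by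
  ext <;> simp [pow_two]

noncomputable def vgnq : Fin 4 → MvPolynomial (Fin 4) ℂ
  | 0 => X 0 ^ 2 + X 1 ^ 2 + X 2 ^ 2 + X 3 ^ 2
  | 1 => X 0 ^ 2 - X 1 ^ 2 + X 2 ^ 2 - X 3 ^ 2
  | 2 => X 0 ^ 2 + X 1 ^ 2 - X 2 ^ 2 - X 3 ^ 2
  | 3 => X 0 ^ 2 - X 1 ^ 2 - X 2 ^ 2 + X 3 ^ 2

theorem vgn_quad_coprime (a b : ℂ) (h : a ≠ b) :
    IsCoprime (Polynomial.X ^ 2 + Polynomial.C a) (Polynomial.X ^ 2 + Polynomial.C b) := by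
  refine ⟨Polynomial.C (a - b)⁻¹, -Polynomial.C (a - b)⁻¹, ?_⟩
  have : Polynomial.C (a - b)⁻¹ * (Polynomial.C a - Polynomial.C b) = 1 := by
    rw [← map_sub, ← map_mul, inv_mul_cancel₀ (sub_ne_zero.mpr h), map_one]
  linear_combination this

theorem vgn_quad_sep (a : ℂ) (h : a ≠ 0) :
    (Polynomial.X ^ 2 + Polynomial.C a).Separable := by
  refine ⟨Polynomial.C a⁻¹, -Polynomial.C (a⁻¹ / 2) * Polynomial.X, ?_⟩
  have h1 : Polynomial.C a⁻¹ * Polynomial.C a = 1 := by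
    rw [← map_mul, inv_mul_cancel₀ h, map_one]
  have h2 : Polynomial.C (a⁻¹ / 2) * 2 = Polynomial.C a⁻¹ := by
    rw [show (2 : Polynomial ℂ) = Polynomial.C 2 from rfl, ← map_mul]
    congr 1
    ring
  simp only [Polynomial.derivative_add, Polynomial.derivative_X_pow, Polynomial.derivative_C]
  have h3 : (Polynomial.C 2 : Polynomial ℂ) = 2 := rfl
  simp [h3]
  linear_combination h1 - Polynomial.X ^ 2 * h2

theorem vgn_univ_squarefree : Squarefree
    ((Polynomial.X ^ 2 + Polynomial.C (21 : ℂ)) * ((Polynomial.X ^ 2 + Polynomial.C (-13)) *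
      ((Polynomial.X ^ 2 + Polynomial.C (-19)) * (Polynomial.X ^ 2 + Polynomial.C 11)))) := by
  apply Polynomial.Separable.squarefree
  refine (vgn_quad_sep _ ?_).mul ((vgn_quad_sep _ ?_).mul ((vgn_quad_sep _ ?_).mul
    (vgn_quad_sep _ ?_) ?_) ?_) ?_
  · norm_num
  · norm_num
  · norm_num
  · norm_num
  · exact vgn_quad_coprime _ _ (by norm_num)
  · exact (vgn_quad_coprime _ _ (by norm_num)).mul_right (vgn_quad_coprime _ _ (by norm_num))
  · exact (vgn_quad_coprime _ _ (by norm_num)).mul_right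
      ((vgn_quad_coprime _ _ (by norm_num)).mul_right (vgn_quad_coprime _ _ (by norm_num)))

theorem vgnq_totalDegree (i : Fin 4) : (vgnq i).totalDegree ≤ 2 := by
  have hX : ∀ j : Fin 4, (X j ^ 2 : MvPolynomial (Fin 4) ℂ).totalDegree ≤ 2 := fun j => by
    simp
  fin_cases i
  · exact (totalDegree_add _ _).trans (max_le ((totalDegree_add _ _).trans (max_le
      ((totalDegree_add _ _).trans (max_le (hX _) (hX _))) (hX _))) (hX _))
  · exact (totalDegree_sub _ _).trans (max_le ((totalDegree_add _ _).trans (max_le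
      ((totalDegree_sub _ _).trans (max_le (hX _) (hX _))) (hX _))) (hX _))
  · exact (totalDegree_sub _ _).trans (max_le ((totalDegree_sub _ _).trans (max_le
      ((totalDegree_add _ _).trans (max_le (hX _) (hX _))) (hX _))) (hX _))
  · exact (totalDegree_add _ _).trans (max_le ((totalDegree_sub _ _).trans (max_le
      ((totalDegree_sub _ _).trans (max_le (hX _) (hX _))) (hX _))) (hX _))

/-- The product of the four quadrics is squarefree: restrict to a line. -/
theorem vgnq_squarefree : Squarefree [vgnq 0, vgnq 1, vgnq 2, vgnq 3].prod := by
  set P := [vgnq 0, vgnq 1, vgnq 2, vgnq 3].prod with hP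
  let v : Fin 4 → Polynomial ℂ :=
    ![Polynomial.X, Polynomial.C 1, Polynomial.C 2, Polynomial.C 4]
  let f : MvPolynomial (Fin 4) ℂ →ₐ[ℂ] Polynomial ℂ := aeval v
  have hdeg : ∀ p, (f p).natDegree ≤ p.totalDegree := fun p => by
    have := aeval_natDegree_le (m := p.totalDegree) (n := 1) p le_rfl v (by
      intro i
      fin_cases i <;> simp [v])
    simpa using this
  have hPd : P.totalDegree ≤ 8 := by
    rw [hP]
    simp only [List.prod_cons, List.prod_nil, mul_one]
    have := vgnq_totalDegree 0
    have := vgnq_totalDegree 1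
    have := vgnq_totalDegree 2
    have := vgnq_totalDegree 3
    have := totalDegree_mul (vgnq 2) (vgnq 3)
    have := totalDegree_mul (vgnq 1) (vgnq 2 * vgnq 3)
    have := totalDegree_mul (vgnq 0) (vgnq 1 * (vgnq 2 * vgnq 3))
    omega
  have hfP : f P = ((Polynomial.X ^ 2 + Polynomial.C (21 : ℂ)) * ((Polynomial.X ^ 2 +
      Polynomial.C (-13)) * ((Polynomial.X ^ 2 + Polynomial.C (-19)) *
      (Polynomial.X ^ 2 + Polynomial.C 11)))) := by
    have hc : ∀ n : ℤ, Polynomial.C (n : ℂ) = (n : Polynomial ℂ) := fun n => by simp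
    have e1 := hc 21
    have e2 := hc (-13)
    have e3 := hc (-19)
    have e4 := hc 11
    have e5 := hc 2
    have e6 := hc 4
    push_cast at e1 e2 e3 e4 e5 e6
    rw [hP]
    simp only [List.prod_cons, List.prod_nil, mul_one, map_mul]
    congr 1
    · simp [f, v, vgnq, e1, e2, e3, e4, e5, e6]; ring
    congr 1
    · simp [f, v, vgnq, e1, e2, e3, e4, e5, e6]; ring
    congr 1
    · simp [f, v, vgnq, e1, e2, e3, e4, e5, e6]; ring
    · simp [f, v, vgnq, e1, e2, e3, e4, e5, e6]; ring
  have hsq : Squarefree (f P) := hfP ▸ vgn_univ_squarefree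
  have hfd : (f P).natDegree = 8 := by
    rw [hfP]
    have hd : ∀ a : ℂ, (Polynomial.X ^ 2 + Polynomial.C a).natDegree = 2 := fun a =>
      Polynomial.natDegree_X_pow_add_C
    have hm : ∀ a : ℂ, (Polynomial.X ^ 2 + Polynomial.C a).Monic := fun a =>
      Polynomial.monic_X_pow_add_C _ two_ne_zero
    rw [Polynomial.Monic.natDegree_mul, Polynomial.Monic.natDegree_mul,
      Polynomial.Monic.natDegree_mul, hd, hd, hd, hd]
    · exact hm _
    · exact hm _
    · exact hm _
    · exact (hm _).mul (hm _)
    · exact hm _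
    · exact (hm _).mul ((hm _).mul (hm _))
  clear_value P
  rintro p ⟨c, rfl⟩
  have h0 : f (p * p * c) ≠ 0 := hsq.ne_zero
  have h0' : p * p * c ≠ 0 := fun h => h0 (by rw [h, map_zero])
  have hpp : p * p ≠ 0 := left_ne_zero_of_mul h0'
  have hc : c ≠ 0 := right_ne_zero_of_mul h0'
  have hp : p ≠ 0 := left_ne_zero_of_mul hpp
  rw [totalDegree_mul_of_isDomain hpp hc, totalDegree_mul_of_isDomain hp hp] at hPd
  have hu : IsUnit (f p) := hsq (f p) ⟨f c, by simp⟩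
  rw [map_mul, map_mul] at h0 hfd
  have h0'' : f p * f p ≠ 0 := left_ne_zero_of_mul h0
  rw [Polynomial.natDegree_mul h0'' (right_ne_zero_of_mul h0),
    Polynomial.natDegree_mul (left_ne_zero_of_mul h0'') (left_ne_zero_of_mul h0'')] at hfd
  have := hdeg p
  have := hdeg c
  have h1 := Polynomial.natDegree_eq_zero_of_isUnit hu
  have hp0 : p.totalDegree = 0 := by omega
  rw [totalDegree_eq_zero_iff_eq_C] at hp0
  rw [hp0] at hp ⊢
  have : coeff 0 p ≠ 0 := fun h => hp (by rw [h, map_zero])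
  exact (IsUnit.mk0 _ this).map C

theorem vgnq_allGood : VgnAllGood _ [vgnq 0, vgnq 1, vgnq 2, vgnq 3] := by
  intro l hl hne
  have hsq : Squarefree l.prod := vgnq_squarefree.squarefree_of_dvd hl.prod_dvd_prod
  have hnu : ¬ IsUnit l.prod := by
    obtain ⟨x, m, rfl⟩ := List.exists_cons_of_ne_nil hne
    intro h
    have hx : IsUnit x := by
      rw [List.prod_cons] at h
      exact isUnit_of_mul_isUnit_left h
    have hxm : x ∈ [vgnq 0, vgnq 1, vgnq 2, vgnq 3] := hl.subset (by simp)
    have h2 := hx.map (eval (0 : Fin 4 → ℂ))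
    simp at hxm
    rcases hxm with rfl | rfl | rfl | rfl <;> simp [vgnq] at h2
  refine ⟨fun s a hs h => ?_, fun s a h => ?_⟩
  · obtain ⟨c, hc⟩ := h
    have hd : s ∣ a * l.prod := (IsIntegrallyClosed.pow_dvd_pow_iff two_ne_zero).mp
      ⟨c * l.prod, by linear_combination l.prod * hc⟩
    obtain ⟨e, he⟩ := hd
    have he2 : e ^ 2 = l.prod * c := by
      apply mul_left_cancel₀ (pow_ne_zero 2 hs)
      linear_combination l.prod * hc - (a * l.prod + s * e) * he
    obtain ⟨f, rfl⟩ : l.prod ∣ e := hsq.isRadical 2 e ⟨c, he2⟩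
    refine ⟨f, mul_right_cancel₀ hsq.ne_zero ?_⟩
    linear_combination he
  · by_contra hs
    have hd : s ∣ a := (IsIntegrallyClosed.pow_dvd_pow_iff two_ne_zero).mp ⟨_, h.symm⟩
    obtain ⟨c, rfl⟩ := hd
    rw [mul_pow] at h
    have := mul_left_cancel₀ (pow_ne_zero 2 hs) h
    apply hnu
    have hc := hsq c ⟨1, by rw [this]; ring⟩
    rw [this]
    exact hc.pow 2

abbrev VgnB1 := VgnQ (MvPolynomial (Fin 4) ℂ) (vgnq 0)
noncomputable abbrev vgnI1 : MvPolynomial (Fin 4) ℂ →+* VgnB1 := algebraMap _ _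
abbrev VgnB2 := VgnQ VgnB1 (vgnI1 (vgnq 1))
noncomputable abbrev vgnI2 : VgnB1 →+* VgnB2 := algebraMap _ _
abbrev VgnB3 := VgnQ VgnB2 (vgnI2 (vgnI1 (vgnq 2)))
noncomputable abbrev vgnI3 : VgnB2 →+* VgnB3 := algebraMap _ _
abbrev VgnB4 := VgnQ VgnB3 (vgnI3 (vgnI2 (vgnI1 (vgnq 3))))
noncomputable abbrev vgnI4 : VgnB3 →+* VgnB4 := algebraMap _ _

theorem vgnB4_normal : IsDomain VgnB4 ∧ IsIntegrallyClosed VgnB4 := by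
  have h0 : IsUnit (2 : MvPolynomial (Fin 4) ℂ) := by
    have := (IsUnit.mk0 (2 : ℂ) two_ne_zero).map (C (σ := Fin 4))
    rwa [map_ofNat] at this
  have h1 := vgn_step _ _ ⟨inferInstance, inferInstance, h0, vgnq_allGood⟩
  have h2 := vgn_step _ _ h1
  have h3 := vgn_step _ _ h2
  have h4 := vgn_step _ _ h3
  exact ⟨h4.1, h4.2.1⟩

abbrev VgnR := MvPolynomial (Fin 8) ℂ ⧸ Ideal.span {vgnF 0, vgnF 1, vgnF 2, vgnF 3}

noncomputable def vgnBase : MvPolynomial (Fin 4) ℂ →+* VgnR :=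
  (Ideal.Quotient.mk _).comp (eval₂Hom C ![X 4, X 5, X 6, X 7])

theorem vgnBase_sq (i : Fin 4) (j : Fin 8) (h : vgnF i ∈ ({vgnF 0, vgnF 1, vgnF 2, vgnF 3} : Set _))
    (h' : X j ^ 2 - eval₂Hom C ![X 4, X 5, X 6, X 7] (vgnq i) = vgnF i) :
    (Ideal.Quotient.mk _ (X j) : VgnR) ^ 2 = vgnBase (vgnq i) := by
  rw [vgnBase, RingHom.comp_apply, ← map_pow, Ideal.Quotient.mk_eq_mk_iff_sub_mem, h']
  exact Ideal.subset_span h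

noncomputable def vgnPsi1 : VgnB1 →+* VgnR :=
  vgnLift vgnBase (Ideal.Quotient.mk _ (X 0)) (vgnBase_sq 0 0 (by simp) (by simp [vgnq, vgnF]))

noncomputable def vgnPsi2 : VgnB2 →+* VgnR :=
  vgnLift vgnPsi1 (Ideal.Quotient.mk _ (X 1)) (by
    rw [vgnPsi1, vgnLift_algebraMap]
    exact vgnBase_sq 1 1 (by simp) (by simp [vgnq, vgnF]))

noncomputable def vgnPsi3 : VgnB3 →+* VgnR :=
  vgnLift vgnPsi2 (Ideal.Quotient.mk _ (X 2)) (by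
    rw [vgnPsi2, vgnLift_algebraMap, vgnPsi1, vgnLift_algebraMap]
    exact vgnBase_sq 2 2 (by simp) (by simp [vgnq, vgnF]))

noncomputable def vgnPsi4 : VgnB4 →+* VgnR :=
  vgnLift vgnPsi3 (Ideal.Quotient.mk _ (X 3)) (by
    rw [vgnPsi3, vgnLift_algebraMap, vgnPsi2, vgnLift_algebraMap, vgnPsi1, vgnLift_algebraMap]
    exact vgnBase_sq 3 3 (by simp) (by simp [vgnq, vgnF]))

noncomputable def vgnIota : MvPolynomial (Fin 4) ℂ →+* VgnB4 :=
  ((vgnI4.comp vgnI3).comp vgnI2).comp vgnI1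

noncomputable def vgnPhi0 : MvPolynomial (Fin 8) ℂ →+* VgnB4 :=
  eval₂Hom (vgnIota.comp C) ![vgnI4 (vgnI3 (vgnI2 QuadraticAlgebra.omega)),
    vgnI4 (vgnI3 QuadraticAlgebra.omega), vgnI4 QuadraticAlgebra.omega, QuadraticAlgebra.omega,
    vgnIota (X 0), vgnIota (X 1), vgnIota (X 2), vgnIota (X 3)]

theorem vgnPhi0_C (c : ℂ) : vgnPhi0 (C c) = vgnIota (C c) := by
  simp [vgnPhi0]
theorem vgnPhi0_X0 : vgnPhi0 (X 0) = vgnI4 (vgnI3 (vgnI2 QuadraticAlgebra.omega)) :=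
  eval₂Hom_X' _ _ _
theorem vgnPhi0_X1 : vgnPhi0 (X 1) = vgnI4 (vgnI3 QuadraticAlgebra.omega) :=
  eval₂Hom_X' _ _ _
theorem vgnPhi0_X2 : vgnPhi0 (X 2) = vgnI4 QuadraticAlgebra.omega := eval₂Hom_X' _ _ _
theorem vgnPhi0_X3 : vgnPhi0 (X 3) = QuadraticAlgebra.omega := eval₂Hom_X' _ _ _
theorem vgnPhi0_X4 : vgnPhi0 (X 4) = vgnIota (X 0) := eval₂Hom_X' _ _ _
theorem vgnPhi0_X5 : vgnPhi0 (X 5) = vgnIota (X 1) := eval₂Hom_X' _ _ _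
theorem vgnPhi0_X6 : vgnPhi0 (X 6) = vgnIota (X 2) := eval₂Hom_X' _ _ _
theorem vgnPhi0_X7 : vgnPhi0 (X 7) = vgnIota (X 3) := eval₂Hom_X' _ _ _

theorem vgnPhi0_F (i : Fin 4) : vgnPhi0 (vgnF i) = 0 := by
  fin_cases i
  · have h : vgnPhi0 (X 0) ^ 2 = vgnIota (vgnq 0) := by
      rw [vgnPhi0_X0, ← map_pow, ← map_pow, ← map_pow, vgn_omega_sq]; rfl
    change vgnPhi0 (X 0 ^ 2 - (X 4 ^ 2 + X 5 ^ 2 + X 6 ^ 2 + X 7 ^ 2)) = 0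
    rw [map_sub, map_pow, h, sub_eq_zero]
    simp only [vgnq, map_add, map_sub, map_pow, vgnPhi0_X4, vgnPhi0_X5, vgnPhi0_X6, vgnPhi0_X7]
  · have h : vgnPhi0 (X 1) ^ 2 = vgnIota (vgnq 1) := by
      rw [vgnPhi0_X1, ← map_pow, ← map_pow, vgn_omega_sq]; rfl
    change vgnPhi0 (X 1 ^ 2 - (X 4 ^ 2 - X 5 ^ 2 + X 6 ^ 2 - X 7 ^ 2)) = 0
    rw [map_sub, map_pow, h, sub_eq_zero]
    simp only [vgnq, map_add, map_sub, map_pow, vgnPhi0_X4, vgnPhi0_X5, vgnPhi0_X6, vgnPhi0_X7]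
  · have h : vgnPhi0 (X 2) ^ 2 = vgnIota (vgnq 2) := by
      rw [vgnPhi0_X2, ← map_pow, vgn_omega_sq]; rfl
    change vgnPhi0 (X 2 ^ 2 - (X 4 ^ 2 + X 5 ^ 2 - X 6 ^ 2 - X 7 ^ 2)) = 0
    rw [map_sub, map_pow, h, sub_eq_zero]
    simp only [vgnq, map_add, map_sub, map_pow, vgnPhi0_X4, vgnPhi0_X5, vgnPhi0_X6, vgnPhi0_X7]
  · have h : vgnPhi0 (X 3) ^ 2 = vgnIota (vgnq 3) := by
      rw [vgnPhi0_X3, vgn_omega_sq]; rfl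
    change vgnPhi0 (X 3 ^ 2 - (X 4 ^ 2 - X 5 ^ 2 - X 6 ^ 2 + X 7 ^ 2)) = 0
    rw [map_sub, map_pow, h, sub_eq_zero]
    simp only [vgnq, map_add, map_sub, map_pow, vgnPhi0_X4, vgnPhi0_X5, vgnPhi0_X6, vgnPhi0_X7]

noncomputable def vgnPhi : VgnR →+* VgnB4 :=
  Ideal.Quotient.lift _ vgnPhi0 (by
    intro a ha
    have : Ideal.span {vgnF 0, vgnF 1, vgnF 2, vgnF 3} ≤ RingHom.ker vgnPhi0 := by
      rw [Ideal.span_le]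
      rintro x (rfl | rfl | rfl | rfl) <;> exact vgnPhi0_F _
    exact this ha)

theorem vgnPhi_mk (x : MvPolynomial (Fin 8) ℂ) : vgnPhi (Ideal.Quotient.mk _ x) = vgnPhi0 x :=
  Ideal.Quotient.lift_mk _ _ _

theorem vgnPsi4_I (x : VgnB3) : vgnPsi4 (vgnI4 x) = vgnPsi3 x := vgnLift_algebraMap _ _ _ _
theorem vgnPsi3_I (x : VgnB2) : vgnPsi3 (vgnI3 x) = vgnPsi2 x := vgnLift_algebraMap _ _ _ _
theorem vgnPsi2_I (x : VgnB1) : vgnPsi2 (vgnI2 x) = vgnPsi1 x := vgnLift_algebraMap _ _ _ _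
theorem vgnPsi1_I (x : MvPolynomial (Fin 4) ℂ) : vgnPsi1 (vgnI1 x) = vgnBase x :=
  vgnLift_algebraMap _ _ _ _
theorem vgnPsi4_omega : vgnPsi4 QuadraticAlgebra.omega = Ideal.Quotient.mk _ (X 3) :=
  vgnLift_omega _ _ _
theorem vgnPsi3_omega : vgnPsi3 QuadraticAlgebra.omega = Ideal.Quotient.mk _ (X 2) :=
  vgnLift_omega _ _ _
theorem vgnPsi2_omega : vgnPsi2 QuadraticAlgebra.omega = Ideal.Quotient.mk _ (X 1) :=
  vgnLift_omega _ _ _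
theorem vgnPsi1_omega : vgnPsi1 QuadraticAlgebra.omega = Ideal.Quotient.mk _ (X 0) :=
  vgnLift_omega _ _ _

theorem vgnPsi4_iota (x : MvPolynomial (Fin 4) ℂ) : vgnPsi4 (vgnIota x) = vgnBase x := by
  change vgnPsi4 (vgnI4 (vgnI3 (vgnI2 (vgnI1 x)))) = _
  rw [vgnPsi4_I, vgnPsi3_I, vgnPsi2_I, vgnPsi1_I]

theorem vgnBase_C (c : ℂ) : vgnBase (C c) = Ideal.Quotient.mk _ (C c) := by
  simp [vgnBase]

theorem vgnBase_X (i : Fin 4) :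
    vgnBase (X i) = Ideal.Quotient.mk _ ((![X 4, X 5, X 6, X 7] : Fin 4 → _) i) := by
  simp [vgnBase]

theorem vgn_psi_phi : vgnPsi4.comp vgnPhi = RingHom.id VgnR := by
  apply Ideal.Quotient.ringHom_ext
  apply MvPolynomial.ringHom_ext
  · intro c
    simp only [RingHom.comp_apply, vgnPhi_mk, vgnPhi0_C, vgnPsi4_iota, vgnBase_C, RingHom.id_apply]
  · intro i
    simp only [RingHom.comp_apply, vgnPhi_mk, RingHom.id_apply]
    fin_cases i
    · exact (congrArg vgnPsi4 vgnPhi0_X0).trans (by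
        rw [vgnPsi4_I, vgnPsi3_I, vgnPsi2_I, vgnPsi1_omega]; rfl)
    · exact (congrArg vgnPsi4 vgnPhi0_X1).trans (by
        rw [vgnPsi4_I, vgnPsi3_I, vgnPsi2_omega]; rfl)
    · exact (congrArg vgnPsi4 vgnPhi0_X2).trans (by rw [vgnPsi4_I, vgnPsi3_omega]; rfl)
    · exact (congrArg vgnPsi4 vgnPhi0_X3).trans (by rw [vgnPsi4_omega]; rfl)
    · exact (congrArg vgnPsi4 vgnPhi0_X4).trans (by rw [vgnPsi4_iota, vgnBase_X]; rfl)
    · exact (congrArg vgnPsi4 vgnPhi0_X5).trans (by rw [vgnPsi4_iota, vgnBase_X]; rfl)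
    · exact (congrArg vgnPsi4 vgnPhi0_X6).trans (by rw [vgnPsi4_iota, vgnBase_X]; rfl)
    · exact (congrArg vgnPsi4 vgnPhi0_X7).trans (by rw [vgnPsi4_iota, vgnBase_X]; rfl)

theorem vgn_mem {B T : Type*} [CommRing B] [CommRing T] {q : B} (S : Subring T)
    (g : VgnQ B q →+* T) (h : ∀ x, g (algebraMap B _ x) ∈ S)
    (h' : g QuadraticAlgebra.omega ∈ S) (z : VgnQ B q) : g z ∈ S := by
  have hz : z = algebraMap B _ z.re + algebraMap B _ z.im * QuadraticAlgebra.omega := by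
    ext <;> simp
  rw [hz, map_add, map_mul]
  exact S.add_mem (h _) (S.mul_mem (h _) h')

theorem vgnIota_mem (x : MvPolynomial (Fin 4) ℂ) : vgnIota x ∈ vgnPhi0.range := by
  induction x using MvPolynomial.induction_on with
  | C c => exact ⟨_, vgnPhi0_C c⟩
  | add p q hp hq =>
    rw [map_add]
    exact add_mem hp hq
  | mul_X p i hp =>
    rw [map_mul]
    refine mul_mem hp ?_
    fin_cases i
    · exact ⟨_, vgnPhi0_X4⟩
    · exact ⟨_, vgnPhi0_X5⟩
    · exact ⟨_, vgnPhi0_X6⟩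
    · exact ⟨_, vgnPhi0_X7⟩

theorem vgnPhi0_surj : Function.Surjective vgnPhi0 := by
  have h1 := vgn_mem vgnPhi0.range ((vgnI4.comp vgnI3).comp vgnI2) vgnIota_mem ⟨_, vgnPhi0_X0⟩
  have h2 := vgn_mem vgnPhi0.range (vgnI4.comp vgnI3) h1 ⟨_, vgnPhi0_X1⟩
  have h3 := vgn_mem vgnPhi0.range vgnI4 h2 ⟨_, vgnPhi0_X2⟩
  exact vgn_mem vgnPhi0.range (RingHom.id _) h3 ⟨_, vgnPhi0_X3⟩

theorem vgn_transfer {R S : Type*} [CommRing R] [CommRing S] (f : R →+* S)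
    (hf : Function.Bijective f) (h : IsDomain S ∧ IsIntegrallyClosed S) :
    IsDomain R ∧ IsIntegrallyClosed R := by
  obtain ⟨_, _⟩ := h
  exact ⟨hf.1.isDomain f, IsIntegrallyClosed.of_equiv (RingEquiv.ofBijective f hf).symm⟩

/-- The quotient of `ℂ[Y₀,…,Y₃,X₀,…,X₃]` by the ideal `(F₀,F₁,F₂,F₃)` is a
normal domain: it is an integral domain which is integrally closed in its
field of fractions. -/
theorem quotient_by_vgn_ideal_is_normal_domain :
    IsDomain (MvPolynomial (Fin 8) ℂ ⧸
      Ideal.span {vgnF 0, vgnF 1, vgnF 2, vgnF 3}) ∧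
    IsIntegrallyClosed (MvPolynomial (Fin 8) ℂ ⧸
      Ideal.span {vgnF 0, vgnF 1, vgnF 2, vgnF 3}) := by
  refine vgn_transfer vgnPhi ⟨?_, ?_⟩ vgnB4_normal
  · exact Function.LeftInverse.injective (g := vgnPsi4) (RingHom.congr_fun vgn_psi_phi)
  · intro y
    obtain ⟨x, hx⟩ := vgnPhi0_surj y
    exact ⟨Ideal.Quotient.mk _ x, (vgnPhi_mk x).trans hx⟩
end

section
/- For every symmetric 2×2 complex matrix Z with positive definite imaginary part, all the theta series below are absolutely summable and the following four identities hold: θ[00;00](Z)² = θ[00;00](2Z)² + θ[10;00](2Z)² + θ[01;00](2Z)² + θ[11;00](2Z)²; θ[00;10](Z)² = θ[00;00](2Z)² − θ[10;00](2Z)² + θ[01;00](2Z)² − θ[11;00](2Z)²; θ[00;01](Z)² = θ[00;00](2Z)² + θ[10;00](2Z)² − θ[01;00](2Z)² − θ[11;00](2Z)²; θ[00;11](Z)² = θ[00;00](2Z)² − θ[10;00](2Z)² − θ[01;00](2Z)² + θ[11;00](2Z)². -/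
open scoped BigOperators

/-- The general term of the theta series with characteristic `[a;b]` at the
point `Z`, indexed by `g ∈ ℤ²`:
`exp(πi·((g+a/2)ᵀ Z (g+a/2) + bᵀ(g+a/2)))`. -/
noncomputable def thetaTerm (a b : Fin 2 → ℂ) (Z : Matrix (Fin 2) (Fin 2) ℂ)
    (g : Fin 2 → ℤ) : ℂ :=
  Complex.exp ((Real.pi : ℂ) * Complex.I *
    ((∑ i : Fin 2, ∑ j : Fin 2,
        ((g i : ℂ) + a i / 2) * Z i j * ((g j : ℂ) + a j / 2)) +
      ∑ i : Fin 2, b i * ((g i : ℂ) + a i / 2)))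

/-- The theta constant `θ[a;b](Z) = ∑_{g∈ℤ²} exp(πi((g+a/2)ᵀZ(g+a/2)+bᵀ(g+a/2)))`. -/
noncomputable def theta (a b : Fin 2 → ℂ) (Z : Matrix (Fin 2) (Fin 2) ℂ) : ℂ :=
  ∑' g : Fin 2 → ℤ, thetaTerm a b Z g

lemma aux_summable_one (c s : ℝ) (hc : 0 < c) :
    Summable fun n : ℤ => Real.exp (-Real.pi * (c * ((n : ℝ) + s) ^ 2)) := by
  have h := ((summable_jacobiTheta₂_term_iff ((c * s : ℝ) * Complex.I)
    ((c : ℝ) * Complex.I)).2 (by simpa using hc)).norm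
  refine (h.mul_left (Real.exp (-Real.pi * (c * s ^ 2)))).congr fun n => ?_
  rw [norm_jacobiTheta₂_term, ← Real.exp_add]
  congr 1
  simp
  ring

lemma aux_quad (x y z : ℝ) (hx : 0 < x) (hd : 0 < x * z - y * y) :
    ∃ c : ℝ, 0 < c ∧ ∀ u v : ℝ, c * u ^ 2 + c * v ^ 2 ≤ x * u ^ 2 + 2 * y * u * v + z * v ^ 2 := by
  have hz : 0 < z := by
    by_contra h
    nlinarith [mul_nonneg hx.le (neg_nonneg.2 (not_lt.1 h)), mul_self_nonneg y]
  have ht : 0 < x + z := by positivity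
  refine ⟨(x * z - y * y) / (x + z), by positivity, fun u v => ?_⟩
  have : x * u ^ 2 + 2 * y * u * v + z * v ^ 2 - ((x * z - y * y) / (x + z) * u ^ 2
      + (x * z - y * y) / (x + z) * v ^ 2) =
      ((x * u + y * v) ^ 2 + (y * u + z * v) ^ 2) / (x + z) := by
    field_simp
    ring
  have h2 : 0 ≤ ((x * u + y * v) ^ 2 + (y * u + z * v) ^ 2) / (x + z) := by positivity
  linarith

lemma aux_norm (α β : Fin 2 → ℝ) (a b : Fin 2 → ℂ) (ha : ∀ i, a i = α i) (hb : ∀ i, b i = β i)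
    (Z : Matrix (Fin 2) (Fin 2) ℂ) (hZ : Z.transpose = Z) (g : Fin 2 → ℤ) :
    ‖thetaTerm a b Z g‖ = Real.exp (-Real.pi * ((Z 0 0).im * (g 0 + α 0 / 2) ^ 2 +
      2 * (Z 0 1).im * (g 0 + α 0 / 2) * (g 1 + α 1 / 2) + (Z 1 1).im * (g 1 + α 1 / 2) ^ 2)) := by
  have hs : Z 1 0 = Z 0 1 := by
    have := congrFun (congrFun hZ 0) 1
    simpa using this
  rw [thetaTerm, Complex.norm_exp]
  congr 1
  simp only [Fin.sum_univ_two, ha, hb, hs]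
  have e : ∀ i, ((g i : ℂ) + (α i : ℂ) / 2) = ((g i + α i / 2 : ℝ) : ℂ) := by
    intro i; push_cast; rfl
  simp only [e]
  simp [-Complex.ofReal_add, -Complex.ofReal_div]
  ring

lemma aux_summable (α β : Fin 2 → ℝ) (a b : Fin 2 → ℂ) (ha : ∀ i, a i = α i) (hb : ∀ i, b i = β i)
    (Z : Matrix (Fin 2) (Fin 2) ℂ) (hZ : Z.transpose = Z)
    (hx : 0 < (Z 0 0).im) (hd : 0 < (Z 0 0).im * (Z 1 1).im - (Z 0 1).im * (Z 0 1).im) :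
    Summable fun g => ‖thetaTerm a b Z g‖ := by
  obtain ⟨c, hc, hq⟩ := aux_quad _ _ _ hx hd
  have h := (aux_summable_one c (α 0 / 2) hc).mul_of_nonneg (aux_summable_one c (α 1 / 2) hc)
    (fun _ => (Real.exp_pos _).le) (fun _ => (Real.exp_pos _).le)
  have h' := (finTwoArrowEquiv ℤ).summable_iff.2 h
  refine Summable.of_nonneg_of_le (fun _ => norm_nonneg _) (fun g => ?_) h'
  rw [aux_norm α β a b ha hb Z hZ]
  simp only [Function.comp, finTwoArrowEquiv_apply, ← Real.exp_add]
  apply Real.exp_le_exp.2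
  have := hq (g 0 + α 0 / 2) (g 1 + α 1 / 2)
  have hpi := Real.pi_pos
  have h3 := mul_le_mul_of_nonneg_left this hpi.le
  change _ ≤ -Real.pi * (c * ((g 0 : ℝ) + α 0 / 2) ^ 2) + -Real.pi * (c * ((g 1 : ℝ) + α 1 / 2) ^ 2)
  linarith

def auxA (a : Fin 2 × Fin 2) : Fin 2 → ℤ := ![((a.1 : ℕ) : ℤ), ((a.2 : ℕ) : ℤ)]

def auxMap (x : (Fin 2 × Fin 2) × ((Fin 2 → ℤ) × (Fin 2 → ℤ))) : (Fin 2 → ℤ) × (Fin 2 → ℤ) :=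
  (fun i => x.2.1 i + x.2.2 i + auxA x.1 i, fun i => x.2.1 i - x.2.2 i)

lemma auxMap_bij : Function.Bijective auxMap := by
  constructor
  · rintro ⟨⟨a, b⟩, p, q⟩ ⟨⟨a', b'⟩, p', q'⟩ h
    simp only [auxMap, auxA, Prod.mk.injEq, funext_iff, Fin.forall_fin_two, Matrix.cons_val_zero,
      Matrix.cons_val_one, Fin.ext_iff] at h ⊢
    omega
  · rintro ⟨g, h⟩
    refine ⟨((⟨((g 0 + h 0) % 2).toNat, by omega⟩, ⟨((g 1 + h 1) % 2).toNat, by omega⟩),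
      fun i => (g i + h i) / 2, fun i => (g i + h i) / 2 - h i), ?_⟩
    simp only [auxMap, auxA, Prod.mk.injEq, funext_iff, Fin.forall_fin_two, Matrix.cons_val_zero,
      Matrix.cons_val_one]
    omega

lemma aux_term (β : Fin 2 → ℤ) (b : Fin 2 → ℂ) (hb : ∀ i, b i = β i)
    (Z : Matrix (Fin 2) (Fin 2) ℂ) (α p q : Fin 2 → ℤ) :
    thetaTerm ![0,0] b Z (fun i => p i + q i + α i) * thetaTerm ![0,0] b Z (fun i => p i - q i) =
    Complex.exp (Real.pi * Complex.I * (β 0 * α 0 + β 1 * α 1)) *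
      (thetaTerm (fun i => α i) ![0,0] ((2 : ℂ) • Z) p *
       thetaTerm (fun i => α i) ![0,0] ((2 : ℂ) • Z) q) := by
  simp only [thetaTerm, ← Complex.exp_add]
  rw [Complex.exp_eq_exp_iff_exists_int]
  refine ⟨β 0 * p 0 + β 1 * p 1, ?_⟩
  simp [Fin.sum_univ_two, hb]
  ring

lemma aux_main (β : Fin 2 → ℤ) (b : Fin 2 → ℂ) (hb : ∀ i, b i = β i)
    (Z : Matrix (Fin 2) (Fin 2) ℂ)
    (h1 : Summable fun g => ‖thetaTerm ![0,0] b Z g‖)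
    (h2 : ∀ α : Fin 2 → ℤ, Summable fun g => ‖thetaTerm (fun i => α i) ![0,0] ((2 : ℂ) • Z) g‖) :
    theta ![0,0] b Z ^ 2 = ∑ a : Fin 2 × Fin 2,
      Complex.exp (Real.pi * Complex.I * (β 0 * auxA a 0 + β 1 * auxA a 1)) *
        theta (fun i => auxA a i) ![0,0] ((2 : ℂ) • Z) ^ 2 := by
  have hs := summable_mul_of_summable_norm h1 h1
  have hs' := (Equiv.ofBijective _ auxMap_bij).summable_iff.2 hs
  rw [sq, theta, tsum_mul_tsum_of_summable_norm h1 h1,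
    ← (Equiv.ofBijective _ auxMap_bij).tsum_eq]
  refine (Summable.tsum_prod hs').trans ?_
  rw [tsum_fintype]
  refine Finset.sum_congr rfl fun a _ => ?_
  rw [sq, theta, tsum_mul_tsum_of_summable_norm (h2 _) (h2 _), ← tsum_mul_left]
  refine tsum_congr fun x => ?_
  exact aux_term β b hb Z (auxA a) x.1 x.2

/-- For every symmetric `2×2` complex matrix `Z` with positive definite
imaginary part, all theta series occurring below are absolutely summable and
the four classical quadratic theta relations hold. -/
theorem theta_relations (Z : Matrix (Fin 2) (Fin 2) ℂ)
    (hZ : Z.transpose = Z)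
    (hIm : (Matrix.of fun i j => (Z i j).im).PosDef) :
    (Summable fun g => ‖thetaTerm ![0,0] ![0,0] Z g‖) ∧
    (Summable fun g => ‖thetaTerm ![0,0] ![1,0] Z g‖) ∧
    (Summable fun g => ‖thetaTerm ![0,0] ![0,1] Z g‖) ∧
    (Summable fun g => ‖thetaTerm ![0,0] ![1,1] Z g‖) ∧
    (Summable fun g => ‖thetaTerm ![0,0] ![0,0] ((2 : ℂ) • Z) g‖) ∧
    (Summable fun g => ‖thetaTerm ![1,0] ![0,0] ((2 : ℂ) • Z) g‖) ∧
    (Summable fun g => ‖thetaTerm ![0,1] ![0,0] ((2 : ℂ) • Z) g‖) ∧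
    (Summable fun g => ‖thetaTerm ![1,1] ![0,0] ((2 : ℂ) • Z) g‖) ∧
    theta ![0,0] ![0,0] Z ^ 2 =
        theta ![0,0] ![0,0] ((2 : ℂ) • Z) ^ 2
      + theta ![1,0] ![0,0] ((2 : ℂ) • Z) ^ 2
      + theta ![0,1] ![0,0] ((2 : ℂ) • Z) ^ 2
      + theta ![1,1] ![0,0] ((2 : ℂ) • Z) ^ 2 ∧
    theta ![0,0] ![1,0] Z ^ 2 =
        theta ![0,0] ![0,0] ((2 : ℂ) • Z) ^ 2
      - theta ![1,0] ![0,0] ((2 : ℂ) • Z) ^ 2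
      + theta ![0,1] ![0,0] ((2 : ℂ) • Z) ^ 2
      - theta ![1,1] ![0,0] ((2 : ℂ) • Z) ^ 2 ∧
    theta ![0,0] ![0,1] Z ^ 2 =
        theta ![0,0] ![0,0] ((2 : ℂ) • Z) ^ 2
      + theta ![1,0] ![0,0] ((2 : ℂ) • Z) ^ 2
      - theta ![0,1] ![0,0] ((2 : ℂ) • Z) ^ 2
      - theta ![1,1] ![0,0] ((2 : ℂ) • Z) ^ 2 ∧
    theta ![0,0] ![1,1] Z ^ 2 =
        theta ![0,0] ![0,0] ((2 : ℂ) • Z) ^ 2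
      - theta ![1,0] ![0,0] ((2 : ℂ) • Z) ^ 2
      - theta ![0,1] ![0,0] ((2 : ℂ) • Z) ^ 2
      + theta ![1,1] ![0,0] ((2 : ℂ) • Z) ^ 2 := by
  have hs : Z 1 0 = Z 0 1 := by
    have := congrFun (congrFun hZ 0) 1
    simpa using this
  have hx : 0 < (Z 0 0).im := by simpa using hIm.diag_pos (i := 0)
  have hd : 0 < (Z 0 0).im * (Z 1 1).im - (Z 0 1).im * (Z 0 1).im := by
    have := hIm.det_pos
    simpa [Matrix.det_fin_two, hs] using this
  have hZ2 : ((2 : ℂ) • Z).transpose = (2 : ℂ) • Z := by rw [Matrix.transpose_smul, hZ]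
  have hx2 : 0 < (((2 : ℂ) • Z) 0 0).im := by simpa using hx
  have hd2 : 0 < (((2 : ℂ) • Z) 0 0).im * (((2 : ℂ) • Z) 1 1).im
      - (((2 : ℂ) • Z) 0 1).im * (((2 : ℂ) • Z) 0 1).im := by
    simp
    nlinarith
  have S1 : ∀ β : Fin 2 → ℤ, Summable fun g => ‖thetaTerm ![0,0] (fun i => β i) Z g‖ := fun β =>
    aux_summable ![0,0] (fun i => β i) _ _ (by simp [Fin.forall_fin_two]) (by simp) Z hZ hx hd
  have S2 : ∀ α : Fin 2 → ℤ,
      Summable fun g => ‖thetaTerm (fun i => α i) ![0,0] ((2 : ℂ) • Z) g‖ := fun α =>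
    aux_summable (fun i => α i) ![0,0] _ _ (by simp) (by simp [Fin.forall_fin_two]) _ hZ2 hx2 hd2
  have M := fun β : Fin 2 → ℤ => aux_main β (fun i => β i) (fun _ => rfl) Z (S1 β) S2
  have c00 : (fun i => ((![0,0] : Fin 2 → ℤ) i : ℂ)) = ![0,0] := by
    ext i; fin_cases i <;> simp
  have c10 : (fun i => ((![1,0] : Fin 2 → ℤ) i : ℂ)) = ![1,0] := by
    ext i; fin_cases i <;> simp
  have c01 : (fun i => ((![0,1] : Fin 2 → ℤ) i : ℂ)) = ![0,1] := by
    ext i; fin_cases i <;> simp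
  have c11 : (fun i => ((![1,1] : Fin 2 → ℤ) i : ℂ)) = ![1,1] := by
    ext i; fin_cases i <;> simp
  have a00 : auxA (0, 0) = ![0,0] := rfl
  have a10 : auxA (1, 0) = ![1,0] := rfl
  have a01 : auxA (0, 1) = ![0,1] := rfl
  have a11 : auxA (1, 1) = ![1,1] := rfl
  have e2 : Complex.exp (Real.pi * Complex.I * (1 + 1)) = 1 := by
    refine Eq.trans ?_ Complex.exp_two_pi_mul_I; congr 1; ring
  refine ⟨by have := S1 ![0,0]; rwa [c00] at this,
    by have := S1 ![1,0]; rwa [c10] at this,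
    by have := S1 ![0,1]; rwa [c01] at this,
    by have := S1 ![1,1]; rwa [c11] at this,
    by have := S2 ![0,0]; rwa [c00] at this,
    by have := S2 ![1,0]; rwa [c10] at this,
    by have := S2 ![0,1]; rwa [c01] at this,
    by have := S2 ![1,1]; rwa [c11] at this, ?_, ?_, ?_, ?_⟩
  · have := M ![0,0]
    simp only [Fintype.sum_prod_type, Fin.sum_univ_two, a00, a10, a01, a11, c00, c10, c01, c11]
      at this
    rw [this]
    simp
    ring
  · have := M ![1,0]
    simp only [Fintype.sum_prod_type, Fin.sum_univ_two, a00, a10, a01, a11, c00, c10, c01, c11]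
      at this
    rw [this]
    simp
    ring
  · have := M ![0,1]
    simp only [Fintype.sum_prod_type, Fin.sum_univ_two, a00, a10, a01, a11, c00, c10, c01, c11]
      at this
    rw [this]
    simp
    ring
  · have := M ![1,1]
    simp only [Fintype.sum_prod_type, Fin.sum_univ_two, a00, a10, a01, a11, c00, c10, c01, c11]
      at this
    rw [this]
    simp [e2]
    ring
end

section
/- In the polynomial ring K[Y₀,Y₁,Y₂,Y₃,X₀,X₁,X₂,X₃], where K = ℚ(ζ₈) is the 8th cyclotomic field, the radical of the ideal generated by Y₀, F₀, F₁, F₂, F₃ is a prime ideal, and the radical of the ideal generated by X₀, F₀, F₁, F₂, F₃ is a prime ideal (i.e. the divisors of Y₀ and of X₀ on 𝒳 are irreducible over K). -/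
open MvPolynomial

/-- The 8th cyclotomic field `K = ℚ(ζ₈)`. -/
noncomputable abbrev K8 : Type := CyclotomicField 8 ℚ

/-- The defining polynomials `F₀, F₁, F₂, F₃` over `K = ℚ(ζ₈)`, in the
variables `Y₀,Y₁,Y₂,Y₃,X₀,X₁,X₂,X₃` (variable `i` for `i < 4` is `Yᵢ`,
variable `4+i` is `Xᵢ`). -/
noncomputable def vgnFK : Fin 4 → MvPolynomial (Fin 8) K8
  | 0 => X 0 ^ 2 - (X 4 ^ 2 + X 5 ^ 2 + X 6 ^ 2 + X 7 ^ 2)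
  | 1 => X 1 ^ 2 - (X 4 ^ 2 - X 5 ^ 2 + X 6 ^ 2 - X 7 ^ 2)
  | 2 => X 2 ^ 2 - (X 4 ^ 2 + X 5 ^ 2 - X 6 ^ 2 - X 7 ^ 2)
  | 3 => X 3 ^ 2 - (X 4 ^ 2 - X 5 ^ 2 - X 6 ^ 2 + X 7 ^ 2)

/-- The field `F(t)` for `t² ∈ F`, `t ∉ F`. -/
def quadField {L : Type*} [Field L] (F : Subfield L) (t : L) (ht : t ^ 2 ∈ F) (htF : t ∉ F) :
    Subfield L where
  carrier := {x | ∃ a ∈ F, ∃ b ∈ F, x = a + b * t}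
  zero_mem' := ⟨0, F.zero_mem, 0, F.zero_mem, by ring⟩
  one_mem' := ⟨1, F.one_mem, 0, F.zero_mem, by ring⟩
  add_mem' := by
    rintro _ _ ⟨a, ha, b, hb, rfl⟩ ⟨c, hc, d, hd, rfl⟩
    exact ⟨a + c, F.add_mem ha hc, b + d, F.add_mem hb hd, by ring⟩
  neg_mem' := by
    rintro _ ⟨a, ha, b, hb, rfl⟩
    exact ⟨-a, F.neg_mem ha, -b, F.neg_mem hb, by ring⟩
  mul_mem' := by
    rintro _ _ ⟨a, ha, b, hb, rfl⟩ ⟨c, hc, d, hd, rfl⟩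
    exact ⟨a * c + b * d * t ^ 2,
      F.add_mem (F.mul_mem ha hc) (F.mul_mem (F.mul_mem hb hd) ht),
      a * d + b * c, F.add_mem (F.mul_mem ha hd) (F.mul_mem hb hc), by ring⟩
  inv_mem' := by
    rintro _ ⟨a, ha, b, hb, rfl⟩
    by_cases h0 : a + b * t = 0
    · exact ⟨0, F.zero_mem, 0, F.zero_mem, by rw [h0]; simp⟩
    have h1 : a - b * t ≠ 0 := by
      intro h
      by_cases hb0 : b = 0
      · subst hb0
        apply h0
        linear_combination h
      · apply htF
        have : t = a / b := by field_simp; linear_combination -h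
        rw [this]
        exact F.div_mem ha hb
    have hn : a ^ 2 - b ^ 2 * t ^ 2 ∈ F :=
      F.sub_mem (F.pow_mem ha 2) (F.mul_mem (F.pow_mem hb 2) ht)
    have h2 : a ^ 2 - b ^ 2 * t ^ 2 ≠ 0 := by
      have : a ^ 2 - b ^ 2 * t ^ 2 = (a + b * t) * (a - b * t) := by ring
      rw [this]
      exact mul_ne_zero h0 h1
    refine ⟨a / (a ^ 2 - b ^ 2 * t ^ 2), F.div_mem ha hn,
      (-b) / (a ^ 2 - b ^ 2 * t ^ 2), F.div_mem (F.neg_mem hb) hn, ?_⟩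
    apply inv_eq_of_mul_eq_one_right
    have h3 : a / (a ^ 2 - b ^ 2 * t ^ 2) + -b / (a ^ 2 - b ^ 2 * t ^ 2) * t
        = (a - b * t) / (a ^ 2 - b ^ 2 * t ^ 2) := by ring
    rw [h3, ← mul_div_assoc, div_eq_one_iff_eq h2]
    ring

/-- The subring `B[t]` for `t² ∈ B`. -/
def quadRing {R : Type*} [CommRing R] (B : Subring R) (t : R) (ht : t ^ 2 ∈ B) : Subring R where
  carrier := {x | ∃ a ∈ B, ∃ b ∈ B, x = a + b * t}
  zero_mem' := ⟨0, B.zero_mem, 0, B.zero_mem, by ring⟩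
  one_mem' := ⟨1, B.one_mem, 0, B.zero_mem, by ring⟩
  add_mem' := by
    rintro _ _ ⟨a, ha, b, hb, rfl⟩ ⟨c, hc, d, hd, rfl⟩
    exact ⟨a + c, B.add_mem ha hc, b + d, B.add_mem hb hd, by ring⟩
  neg_mem' := by
    rintro _ ⟨a, ha, b, hb, rfl⟩
    exact ⟨-a, B.neg_mem ha, -b, B.neg_mem hb, by ring⟩
  mul_mem' := by
    rintro _ _ ⟨a, ha, b, hb, rfl⟩ ⟨c, hc, d, hd, rfl⟩
    exact ⟨a * c + b * d * t ^ 2,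
      B.add_mem (B.mul_mem ha hc) (B.mul_mem (B.mul_mem hb hd) ht),
      a * d + b * c, B.add_mem (B.mul_mem ha hd) (B.mul_mem hb hc), by ring⟩

lemma list_prod_sq {R : Type*} [CommRing R] (l : List R) :
    (l.map (fun x => x ^ 2)).prod = l.prod ^ 2 := by
  induction l with
  | nil => simp
  | cons a l ih => rw [List.map_cons, List.prod_cons, List.prod_cons, ih]; ring

/-- Kummer-type tower argument. -/
lemma tower_injective {R L : Type*} [CommRing R] [Field L] [CharZero L] (φ : R →+* L)
    (ts : List R) : ∀ (B : Subring R) (F : Subfield L), (∀ x ∈ B, φ x ∈ F) →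
      (∀ x ∈ B, φ x = 0 → x = 0) → (∀ t ∈ ts, t ^ 2 ∈ B) →
      (∀ l : List R, l.Sublist ts → l ≠ [] → φ l.prod ∉ F) →
      ∃ B' : Subring R, B ≤ B' ∧ (∀ t ∈ ts, t ∈ B') ∧ ∀ x ∈ B', φ x = 0 → x = 0 := by
  induction ts with
  | nil =>
    intro B F _ hinj _ _
    exact ⟨B, le_rfl, by simp, hinj⟩
  | cons t ts ih =>
    intro B F hBF hinj hsq hprod
    have htB : t ^ 2 ∈ B := hsq t (by simp)
    have htF : φ t ∉ F := by
      have := hprod [t] (by simp) (by simp)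
      simpa using this
    have ht2 : (φ t) ^ 2 ∈ F := by
      rw [← map_pow]
      exact hBF _ htB
    have hle : B ≤ quadRing B t htB := fun x hx => ⟨x, hx, 0, B.zero_mem, by ring⟩
    have htmem : t ∈ quadRing B t htB := ⟨0, B.zero_mem, 1, B.one_mem, by ring⟩
    refine Exists.elim (ih (quadRing B t htB) (quadField F (φ t) ht2 htF) ?_ ?_ ?_ ?_) ?_
    pick_goal 5
    · rintro B' ⟨hB', hts, hi⟩
      refine ⟨B', hle.trans hB', ?_, hi⟩
      intro s hs
      rcases List.mem_cons.1 hs with rfl | hs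
      · exact hB' htmem
      · exact hts s hs
    · rintro _ ⟨a, ha, b, hb, rfl⟩
      exact ⟨φ a, hBF a ha, φ b, hBF b hb, by simp⟩
    · rintro _ ⟨a, ha, b, hb, rfl⟩ h
      rw [map_add, map_mul] at h
      have hb0 : φ b = 0 := by
        by_contra hne
        apply htF
        have : φ t = -φ a / φ b := by field_simp; linear_combination h
        rw [this]
        exact F.div_mem (F.neg_mem (hBF a ha)) (hBF b hb)
      have ha0 : φ a = 0 := by rw [hb0] at h; linear_combination h
      rw [hinj a ha ha0, hinj b hb hb0]
      ring
    · intro s hs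
      exact hle (hsq s (by simp [hs]))
    · intro l hl hne hmem
      obtain ⟨a, ha, b, hb, hab⟩ := hmem
      have hl2 : (φ l.prod) ^ 2 ∈ F := by
        rw [← map_pow]
        apply hBF
        rw [← list_prod_sq]
        apply B.list_prod_mem
        intro x hx
        obtain ⟨y, hy, rfl⟩ := List.mem_map.1 hx
        exact hsq y (by simp [hl.subset hy])
      by_cases hb0 : b = 0
      · apply hprod l (hl.cons t) hne
        rw [hab, hb0]
        simpa using ha
      by_cases ha0 : a = 0
      · apply hprod (t :: l) (hl.cons_cons t) (by simp)
        rw [List.prod_cons, map_mul, hab, ha0]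
        have : φ t * (0 + b * φ t) = b * φ t ^ 2 := by ring
        rw [this]
        exact F.mul_mem hb ht2
      · apply htF
        have : φ t = ((φ l.prod) ^ 2 - a ^ 2 - b ^ 2 * φ t ^ 2) / (2 * a * b) := by
          rw [hab]; field_simp; ring
        rw [this]
        refine F.div_mem (F.sub_mem (F.sub_mem hl2 (F.pow_mem ha 2))
          (F.mul_mem (F.pow_mem hb 2) ht2)) (F.mul_mem (F.mul_mem ?_ ha) hb)
        exact ofNat_mem F 2

/-- Products of polynomials with transversal separating points are not squares. -/
lemma prod_not_square {K : Type*} [Field K] (f : Fin 4 → MvPolynomial (Fin 3) K)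
    (v : Fin 4 → Fin 3 → K) (d : Fin 4 → Fin 3)
    (h0 : ∀ i, eval (v i) (f i) = 0) (h1 : ∀ i j, j ≠ i → eval (v i) (f j) ≠ 0)
    (hd : ∀ i, eval (v i) (pderiv (d i) (f i)) ≠ 0)
    (l : List (Fin 4)) (hl : l.Nodup) (hne : l ≠ []) (h : MvPolynomial (Fin 3) K)
    (hh : h ^ 2 = (l.map f).prod) : False := by
  obtain _ | ⟨i, r⟩ := l
  · exact hne rfl
  rw [List.nodup_cons] at hl
  rw [List.map_cons, List.prod_cons] at hh
  have hz : eval (v i) h = 0 := by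
    have := congrArg (eval (v i)) hh
    rw [map_pow, map_mul, h0, zero_mul] at this
    exact pow_eq_zero_iff (two_ne_zero) |>.1 this
  have hD := congrArg (fun p => eval (v i) (pderiv (d i) p)) hh
  simp only [sq, Derivation.leibniz, map_add, smul_eq_mul, map_mul, hz, h0, zero_mul, zero_add,
    add_zero] at hD
  have hr : eval (v i) (r.map f).prod ≠ 0 := by
    rw [map_list_prod]
    apply List.prod_ne_zero
    intro hmem
    obtain ⟨y, hy, hy0⟩ := List.mem_map.1 hmem
    obtain ⟨j, hj, rfl⟩ := List.mem_map.1 hy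
    exact h1 i j (fun hji => hl.1 (hji ▸ hj)) hy0
  exact mul_ne_zero hr (hd i) hD.symm

lemma isDomain_of_tower {K R : Type} [Field K] [CharZero K] [CommRing R]
    (f : Fin 4 → MvPolynomial (Fin 3) K)
    (v : Fin 4 → Fin 3 → K) (d : Fin 4 → Fin 3)
    (h0 : ∀ i, eval (v i) (f i) = 0) (h1 : ∀ i j, j ≠ i → eval (v i) (f j) ≠ 0)
    (hd : ∀ i, eval (v i) (pderiv (d i) (f i)) ≠ 0)
    (ι : MvPolynomial (Fin 3) K →+* R) (t : Fin 4 → R) (ht : ∀ i, t i ^ 2 = ι (f i))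
    (hgen : ∀ B : Subring R, ι.range ≤ B → (∀ i, t i ∈ B) → B = ⊤)
    (hext : ∀ (L : Type) [Field L] (j : MvPolynomial (Fin 3) K →+* L) (s : Fin 4 → L),
      (∀ i, s i ^ 2 = j (f i)) → ∃ φ : R →+* L, φ.comp ι = j ∧ ∀ i, φ (t i) = s i) :
    IsDomain R := by
  let P := MvPolynomial (Fin 3) K
  let E := FractionRing P
  let L := AlgebraicClosure E
  have : CharZero P := inferInstanceAs (CharZero (MvPolynomial (Fin 3) K))
  have : CharZero E := charZero_of_injective_algebraMap (IsFractionRing.injective P E)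
  have : CharZero L := charZero_of_injective_algebraMap (algebraMap E L).injective
  let j : P →+* L := (algebraMap E L).comp (algebraMap P E)
  have hj : Function.Injective j := (algebraMap E L).injective.comp (IsFractionRing.injective P E)
  have hs : ∀ i, ∃ z : L, z ^ 2 = j (f i) := fun i =>
    IsAlgClosed.exists_pow_nat_eq _ (by norm_num)
  choose s hs using hs
  obtain ⟨φ, hφι, hφt⟩ := hext L j s hs
  have hφι' : ∀ p, φ (ι p) = j p := fun p => by rw [← hφι]; rfl
  refine Exists.elim (tower_injective φ ((List.finRange 4).map t) ι.range
    (algebraMap E L).fieldRange ?_ ?_ ?_ ?_) ?_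
  pick_goal 5
  · rintro B ⟨hB, hBt, hBi⟩
    have htop := hgen B hB (fun i => hBt _ (List.mem_map.2 ⟨i, List.mem_finRange i, rfl⟩))
    have hinj : Function.Injective φ := by
      rw [injective_iff_map_eq_zero]
      intro a ha
      exact hBi a (by rw [htop]; trivial) ha
    exact hinj.isDomain φ
  · rintro _ ⟨p, rfl⟩
    rw [hφι']
    exact ⟨algebraMap P E p, rfl⟩
  · rintro _ ⟨p, rfl⟩ hp
    rw [hφι'] at hp
    rw [(map_eq_zero_iff j hj).1 hp, map_zero]
  · intro x hx
    obtain ⟨i, -, rfl⟩ := List.mem_map.1 hx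
    exact ⟨f i, (ht i).symm⟩
  · intro l hl hne hmem
    obtain ⟨m, hm, rfl⟩ := List.sublist_map_iff.1 hl
    obtain ⟨x, hx⟩ := hmem
    have hx2 : x ^ 2 = algebraMap P E (m.map f).prod := by
      apply (algebraMap E L).injective
      rw [map_pow, hx, ← map_pow, ← list_prod_sq, List.map_map]
      have : (List.map ((fun x => x ^ 2) ∘ t) m) = (m.map f).map ι := by
        rw [List.map_map]
        apply List.map_congr_left
        intro i _
        exact ht i
      rw [this, ← map_list_prod, hφι']
      rfl
    have hint : IsIntegral P x := by
      apply IsIntegral.of_pow (n := 2) (by norm_num)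
      rw [hx2]
      exact isIntegral_algebraMap
    obtain ⟨h, rfl⟩ := IsIntegrallyClosed.isIntegral_iff.1 hint
    refine prod_not_square f v d h0 h1 hd m (hm.nodup (List.nodup_finRange 4)) ?_ h ?_
    · rintro rfl
      exact hne rfl
    · apply IsFractionRing.injective P E
      rw [map_pow]
      exact hx2

lemma exists_i : ∃ i : K8, i ^ 2 = -1 := by
  have inst : IsCyclotomicExtension {8} ℚ K8 := CyclotomicField.isCyclotomicExtension 8 ℚ
  have h := IsCyclotomicExtension.zeta_spec 8 ℚ K8
  refine ⟨IsCyclotomicExtension.zeta 8 ℚ K8 ^ 2, ?_⟩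
  have h8 := h.pow_eq_one
  have h4 : IsCyclotomicExtension.zeta 8 ℚ K8 ^ 4 ≠ 1 :=
    h.pow_ne_one_of_pos_of_lt (by norm_num) (by norm_num)
  have : (IsCyclotomicExtension.zeta 8 ℚ K8 ^ 4 - 1) *
      (IsCyclotomicExtension.zeta 8 ℚ K8 ^ 4 + 1) = 0 := by
    linear_combination h8
  rcases mul_eq_zero.1 this with h | h
  · exact absurd (sub_eq_zero.1 h) h4
  · linear_combination h

lemma subring_eq_top {I : Ideal (MvPolynomial (Fin 8) K8)}
    (B : Subring (MvPolynomial (Fin 8) K8 ⧸ I))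
    (hC : ∀ a, Ideal.Quotient.mk I (C a) ∈ B) (hX : ∀ i, Ideal.Quotient.mk I (X i) ∈ B) :
    B = ⊤ := by
  rw [eq_top_iff]
  rintro x -
  obtain ⟨p, rfl⟩ := Ideal.Quotient.mk_surjective x
  induction p using MvPolynomial.induction_on with
  | C a => exact hC a
  | add p q hp hq => rw [map_add]; exact B.add_mem hp hq
  | mul_X p i hp => rw [map_mul]; exact B.mul_mem hp (hX i)

lemma prime_Y : (Ideal.span {X 0, vgnFK 0, vgnFK 1, vgnFK 2, vgnFK 3} :
        Ideal (MvPolynomial (Fin 8) K8)).IsPrime := by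
  set I := (Ideal.span {X 0, vgnFK 0, vgnFK 1, vgnFK 2, vgnFK 3} :
        Ideal (MvPolynomial (Fin 8) K8)) with hI
  rw [← Ideal.Quotient.isDomain_iff_prime]
  have m0 : Ideal.Quotient.mk I (X 0) = 0 :=
    Ideal.Quotient.eq_zero_iff_mem.2 (Ideal.subset_span (by simp))
  have m1 : Ideal.Quotient.mk I (vgnFK 0) = 0 :=
    Ideal.Quotient.eq_zero_iff_mem.2 (Ideal.subset_span (by simp))
  have m2 : Ideal.Quotient.mk I (vgnFK 1) = 0 :=
    Ideal.Quotient.eq_zero_iff_mem.2 (Ideal.subset_span (by simp))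
  have m3 : Ideal.Quotient.mk I (vgnFK 2) = 0 :=
    Ideal.Quotient.eq_zero_iff_mem.2 (Ideal.subset_span (by simp))
  have m4 : Ideal.Quotient.mk I (vgnFK 3) = 0 :=
    Ideal.Quotient.eq_zero_iff_mem.2 (Ideal.subset_span (by simp))
  simp only [vgnFK, map_sub, map_add, map_pow] at m1 m2 m3 m4
  obtain ⟨i, hi⟩ := exists_i
  have c8 : (C 2 : MvPolynomial (Fin 8) K8) = 2 := map_ofNat C 2
  have d8 : Ideal.Quotient.mk I (C 2) = 2 := by rw [c8]; exact map_ofNat (Ideal.Quotient.mk I) 2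
  have c3 : (C 2 : MvPolynomial (Fin 3) K8) = 2 := map_ofNat C 2
  refine isDomain_of_tower (K := K8)
    ![-(X 0 ^ 2 + X 1 ^ 2 + X 2 ^ 2), C 2 * (X 0 ^ 2 + X 2 ^ 2), C 2 * (X 0 ^ 2 + X 1 ^ 2),
      - C 2 * (X 1 ^ 2 + X 2 ^ 2)]
    ![![3, 4, 5 * i], ![1, 2, i], ![1, i, 2], ![2, 1, i]] ![0, 0, 0, 1] ?_ ?_ ?_
    ((Ideal.Quotient.mk I).comp (aeval ![X 4, X 5, X 6]).toRingHom)
    (fun k => Ideal.Quotient.mk I (![X 7, X 1, X 2, X 3] k)) ?_ ?_ ?_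
  · intro k
    fin_cases k <;> simp [mul_pow, hi] <;> norm_num
  · intro k l hkl
    fin_cases k <;> fin_cases l <;> first | exact absurd rfl hkl | (simp [mul_pow, hi]; try norm_num)
  · intro k
    fin_cases k <;> simp [pderiv_X]
  · intro k
    fin_cases k <;> simp [d8]
    · linear_combination (Ideal.Quotient.mk I (X 0)) * m0 - m1
    · linear_combination m2 + m1 - (Ideal.Quotient.mk I (X 0)) * m0
    · linear_combination m3 + m1 - (Ideal.Quotient.mk I (X 0)) * m0
    · linear_combination m4 - m1 + (Ideal.Quotient.mk I (X 0)) * m0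
  · intro B hB ht
    have hC : ∀ a, Ideal.Quotient.mk I (C a) ∈ B := fun a => hB ⟨C a, by simp⟩
    apply subring_eq_top B hC
    intro k
    fin_cases k
    · have : Ideal.Quotient.mk I (X 0) ∈ B := by rw [m0]; exact B.zero_mem
      exact this
    · exact ht 1
    · exact ht 2
    · exact ht 3
    · exact hB ⟨X 0, by simp⟩
    · exact hB ⟨X 1, by simp⟩
    · exact hB ⟨X 2, by simp⟩
    · exact ht 0
  · intro L _ j s hs
    have s0 := hs 0
    have s1 := hs 1
    have s2 := hs 2
    have s3 := hs 3
    have dj : j (C 2) = 2 := by rw [c3]; exact map_ofNat j 2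
    simp [dj] at s0 s1 s2 s3
    refine ⟨Ideal.Quotient.lift I (eval₂Hom (j.comp C)
      ![0, s 1, s 2, s 3, j (X 0), j (X 1), j (X 2), s 0]) ?_, ?_, ?_⟩
    · intro a ha
      revert a
      change I ≤ RingHom.ker _
      rw [hI, Ideal.span_le]
      intro a ha
      simp only [Set.mem_insert_iff, Set.mem_singleton_iff] at ha
      rw [SetLike.mem_coe, RingHom.mem_ker]
      rcases ha with rfl | rfl | rfl | rfl | rfl
      · simp
      · simp [vgnFK]; linear_combination -s0
      · simp [vgnFK]; linear_combination s1 + s0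
      · simp [vgnFK]; linear_combination s2 + s0
      · simp [vgnFK]; linear_combination s3 - s0
    · apply MvPolynomial.ringHom_ext
      · intro a; simp
      · intro k; fin_cases k <;> simp
    · intro k; fin_cases k <;> simp

lemma prime_X : (Ideal.span {X 4, vgnFK 0, vgnFK 1, vgnFK 2, vgnFK 3} :
        Ideal (MvPolynomial (Fin 8) K8)).IsPrime := by
  set I := (Ideal.span {X 4, vgnFK 0, vgnFK 1, vgnFK 2, vgnFK 3} :
        Ideal (MvPolynomial (Fin 8) K8)) with hI
  rw [← Ideal.Quotient.isDomain_iff_prime]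
  have m0 : Ideal.Quotient.mk I (X 4) = 0 :=
    Ideal.Quotient.eq_zero_iff_mem.2 (Ideal.subset_span (by simp))
  have m1 : Ideal.Quotient.mk I (vgnFK 0) = 0 :=
    Ideal.Quotient.eq_zero_iff_mem.2 (Ideal.subset_span (by simp))
  have m2 : Ideal.Quotient.mk I (vgnFK 1) = 0 :=
    Ideal.Quotient.eq_zero_iff_mem.2 (Ideal.subset_span (by simp))
  have m3 : Ideal.Quotient.mk I (vgnFK 2) = 0 :=
    Ideal.Quotient.eq_zero_iff_mem.2 (Ideal.subset_span (by simp))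
  have m4 : Ideal.Quotient.mk I (vgnFK 3) = 0 :=
    Ideal.Quotient.eq_zero_iff_mem.2 (Ideal.subset_span (by simp))
  simp only [vgnFK, map_sub, map_add, map_pow] at m1 m2 m3 m4
  obtain ⟨i, hi⟩ := exists_i
  refine isDomain_of_tower (K := K8)
    ![X 0 ^ 2 + X 1 ^ 2 + X 2 ^ 2, -X 0 ^ 2 + X 1 ^ 2 - X 2 ^ 2, X 0 ^ 2 - X 1 ^ 2 - X 2 ^ 2,
      -X 0 ^ 2 - X 1 ^ 2 + X 2 ^ 2]
    ![![3, 4, 5 * i], ![3, 5, 4], ![5, 3, 4], ![3, 4, 5]] ![0, 0, 0, 0] ?_ ?_ ?_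
    ((Ideal.Quotient.mk I).comp (aeval ![X 5, X 6, X 7]).toRingHom)
    (fun k => Ideal.Quotient.mk I (![X 0, X 1, X 2, X 3] k)) ?_ ?_ ?_
  · intro k
    fin_cases k <;> simp [mul_pow, hi] <;> norm_num
  · intro k l hkl
    fin_cases k <;> fin_cases l <;> first | exact absurd rfl hkl | (simp [mul_pow, hi]; try norm_num)
  · intro k
    fin_cases k <;> simp [pderiv_X]
  · intro k
    fin_cases k <;> simp
    · linear_combination m1 + (Ideal.Quotient.mk I (X 4)) * m0
    · linear_combination m2 + (Ideal.Quotient.mk I (X 4)) * m0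
    · linear_combination m3 + (Ideal.Quotient.mk I (X 4)) * m0
    · linear_combination m4 + (Ideal.Quotient.mk I (X 4)) * m0
  · intro B hB ht
    have hC : ∀ a, Ideal.Quotient.mk I (C a) ∈ B := fun a => hB ⟨C a, by simp⟩
    apply subring_eq_top B hC
    intro k
    fin_cases k
    · exact ht 0
    · exact ht 1
    · exact ht 2
    · exact ht 3
    · have : Ideal.Quotient.mk I (X 4) ∈ B := by rw [m0]; exact B.zero_mem
      exact this
    · exact hB ⟨X 0, by simp⟩
    · exact hB ⟨X 1, by simp⟩
    · exact hB ⟨X 2, by simp⟩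
  · intro L _ j s hs
    have s0 := hs 0
    have s1 := hs 1
    have s2 := hs 2
    have s3 := hs 3
    simp at s0 s1 s2 s3
    refine ⟨Ideal.Quotient.lift I (eval₂Hom (j.comp C)
      ![s 0, s 1, s 2, s 3, 0, j (X 0), j (X 1), j (X 2)]) ?_, ?_, ?_⟩
    · intro a ha
      revert a
      change I ≤ RingHom.ker _
      rw [hI, Ideal.span_le]
      intro a ha
      simp only [Set.mem_insert_iff, Set.mem_singleton_iff] at ha
      rw [SetLike.mem_coe, RingHom.mem_ker]
      rcases ha with rfl | rfl | rfl | rfl | rfl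
      · simp
      · simp [vgnFK]; linear_combination s0
      · simp [vgnFK]; linear_combination s1
      · simp [vgnFK]; linear_combination s2
      · simp [vgnFK]; linear_combination s3
    · apply MvPolynomial.ringHom_ext
      · intro a; simp
      · intro k; fin_cases k <;> simp
    · intro k; fin_cases k <;> simp

/-- Over `K = ℚ(ζ₈)`, the divisors of `Y₀` and of `X₀` on `𝒳` are
irreducible: the radicals of the ideals `(Y₀,F₀,F₁,F₂,F₃)` and
`(X₀,F₀,F₁,F₂,F₃)` of `K[Y₀,…,X₃]` are prime ideals. -/
theorem radical_ideals_prime_over_cyclotomic :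
    (Ideal.span {X 0, vgnFK 0, vgnFK 1, vgnFK 2, vgnFK 3} :
        Ideal (MvPolynomial (Fin 8) K8)).radical.IsPrime ∧
    (Ideal.span {X 4, vgnFK 0, vgnFK 1, vgnFK 2, vgnFK 3} :
        Ideal (MvPolynomial (Fin 8) K8)).radical.IsPrime := by
  exact ⟨prime_Y.radical.symm ▸ prime_Y, prime_X.radical.symm ▸ prime_X⟩
end
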